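/- arXiv:2503.09301 — 2 statements merged into one kernel-verified Lean document; each statement's English description precedes it below -/
import Mathlib

section
/- Let (ℌ_n, 𝔅_n, 𝔓_n) be a separating basis for C_n with respect to 𝔄_n, and write F_n = span(ℌ_n), P_n = span(𝔓_n). Then the assignment ρ(z) ↦ z for z ∈ ℌ_n defines a linear isomorphism θ_n : span(ρ(ℌ_n)) → F_n, and the projection j_{F_n} : C_n → F_n onto F_n along span(𝔅_n) ⊕ P_n agrees with θ_n ∘ j_{ρ(ℌ_n)} on the subspace F_n ⊕ P_n. -/
open LinearMap Submodule

/-! ## Gradings of vector spaces -/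

/-- An internal grading of a vector space `V` by an index type `ι`, given by a
system of orthogonal idempotent projections which sum (pointwise, with finite
support) to the identity.  The graded piece at `i` is the range of `proj i`. -/
structure VGrading (k V ι : Type*) [Field k] [AddCommGroup V] [Module k V] where
  proj : ι → V →ₗ[k] V
  proj_idem : ∀ i, proj i ∘ₗ proj i = proj i
  proj_orth : ∀ i j, i ≠ j → proj i ∘ₗ proj j = 0
  proj_finite : ∀ v : V, (Function.support fun i => proj i v).Finite
  proj_total : ∀ v : V, (∑ᶠ i, proj i v) = v

namespace VGrading

variable {k V ι : Type*} [Field k] [AddCommGroup V] [Module k V]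

/-- The graded piece of a grading at index `i`. -/
def piece (G : VGrading k V ι) (i : ι) : Submodule k V := LinearMap.range (G.proj i)

end VGrading

/-- The `(i,j)` component of a linear map between `ι`-graded vector spaces:
include the `j`-th piece, apply `f`, project to the `i`-th piece. -/
def gcomp {k V W ι : Type*} [Field k] [AddCommGroup V] [Module k V]
    [AddCommGroup W] [Module k W]
    (GW : VGrading k W ι) (GV : VGrading k V ι) (f : V →ₗ[k] W) (i j : ι) :
    V →ₗ[k] W :=
  GW.proj i ∘ₗ (f ∘ₗ GV.proj j)

/-! ## Contractions and perturbations -/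

/-- A contraction `(f, g, h)` from the differential `dC` on `V` onto the
differential `dD` on `W`: `f, g` are chain maps, `f ∘ g = 1`,
`g ∘ f = 1 + dC h + h dC`, and the side conditions `f h = 0`, `h g = 0`,
`h h = 0` hold. -/
structure IsContraction {k V W : Type*} [Field k] [AddCommGroup V] [Module k V]
    [AddCommGroup W] [Module k W]
    (dC : V →ₗ[k] V) (dD : W →ₗ[k] W)
    (f : V →ₗ[k] W) (g : W →ₗ[k] V) (h : V →ₗ[k] V) : Prop where
  f_chain : f ∘ₗ dC = dD ∘ₗ f
  g_chain : g ∘ₗ dD = dC ∘ₗ g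
  fg : f ∘ₗ g = LinearMap.id
  gf : g ∘ₗ f = LinearMap.id + dC ∘ₗ h + h ∘ₗ dC
  fh : f ∘ₗ h = 0
  hg : h ∘ₗ g = 0
  hh : h ∘ₗ h = 0

/-- Iterated composition of an endomorphism. -/
def endPow {k V : Type*} [Field k] [AddCommGroup V] [Module k V]
    (f : V →ₗ[k] V) : ℕ → (V →ₗ[k] V)
  | 0 => LinearMap.id
  | n + 1 => f ∘ₗ endPow f n

/-- `S` is the sum `Σ_{n ≥ 0} δ (h δ)^n`, which is well defined whenever
`h δ` is locally nilpotent: on every vector the series is eventually zero and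
`S` is given by the corresponding finite partial sum. -/
def IsPerturbSum {k V : Type*} [Field k] [AddCommGroup V] [Module k V]
    (δ h S : V →ₗ[k] V) : Prop :=
  ∀ v : V, ∃ N : ℕ, (∀ m : ℕ, N ≤ m → endPow (h ∘ₗ δ) m v = 0) ∧
    S v = ∑ i ∈ Finset.range N, (δ ∘ₗ endPow (h ∘ₗ δ) i) v

/-! ## Chain complexes over a field (graded by `ℤ`) -/

/-- A chain complex of `k`-vector spaces, realised internally to a single
carrier `V`: a `ℤ`-grading together with a square-zero differential of
degree `-1`. -/
structure ZCC (k V : Type*) [Field k] [AddCommGroup V] [Module k V] where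
  gr : VGrading k V ℤ
  d : V →ₗ[k] V
  d_sq : d ∘ₗ d = 0
  d_deg : ∀ n : ℤ, ∀ v ∈ gr.piece n, d v ∈ gr.piece (n - 1)

namespace ZCC

variable {k V : Type*} [Field k] [AddCommGroup V] [Module k V]

/-- `n`-cycles. -/
def cycles (C : ZCC k V) (n : ℤ) : Submodule k V := C.gr.piece n ⊓ LinearMap.ker C.d

/-- `n`-boundaries. -/
def bdries (C : ZCC k V) (n : ℤ) : Submodule k V := (C.gr.piece (n + 1)).map C.d

/-- The `n`-th homology `ker d_n / im d_{n+1}`. -/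
abbrev homology (C : ZCC k V) (n : ℤ) :=
  ↥(C.cycles n) ⧸ Submodule.comap (C.cycles n).subtype (C.bdries n)

/-- A chain complex is bounded if only finitely many chain groups are nonzero. -/
def Bounded (C : ZCC k V) : Prop := {n : ℤ | C.gr.proj n ≠ 0}.Finite

end ZCC

/-- A map between `ℤ`-graded spaces has degree `r`. -/
def HasDeg {k V W : Type*} [Field k] [AddCommGroup V] [Module k V]
    [AddCommGroup W] [Module k W]
    (GV : VGrading k V ℤ) (GW : VGrading k W ℤ) (f : V →ₗ[k] W) (r : ℤ) : Prop :=
  ∀ n : ℤ, ∀ v ∈ GV.piece n, f v ∈ GW.piece (n + r)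

/-! ## Based complexes and algebraic Morse theory -/

/-- A based complex: a chain complex whose chain groups are further decomposed
as direct sums indexed by `ι`; `deg : ι → ℤ` records which chain group each
basis index belongs to.  Components of the differential can only drop the
degree by one. -/
structure BasedComplex (k V ι : Type*) [Field k] [AddCommGroup V] [Module k V] where
  gr : VGrading k V ι
  deg : ι → ℤ
  d : V →ₗ[k] V
  d_sq : d ∘ₗ d = 0
  d_comp_deg : ∀ α β : ι, deg β ≠ deg α - 1 → gr.proj β ∘ₗ (d ∘ₗ gr.proj α) = 0

namespace BasedComplex

variable {k V ι : Type*} [Field k] [AddCommGroup V] [Module k V]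

/-- The component `d^{βα} : K^α → K^β` of the differential (as an endomorphism
of the carrier). -/
def dcomp (K : BasedComplex k V ι) (β α : ι) : V →ₗ[k] V :=
  K.gr.proj β ∘ₗ (K.d ∘ₗ K.gr.proj α)

/-- The digraph `G_K`: there is an edge `α → β` whenever `d^{βα} ≠ 0`. -/
def Edge (K : BasedComplex k V ι) (α β : ι) : Prop := K.dcomp β α ≠ 0

/-- The component `d^{βα}` restricts to an isomorphism `K^α → K^β`. -/
def CompIso (K : BasedComplex k V ι) (α β : ι) : Prop :=
  (∀ v ∈ K.gr.piece α, K.dcomp β α v = 0 → v = 0) ∧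
  (K.gr.piece α).map (K.dcomp β α) = K.gr.piece β

/-- The edge relation of the digraph `G^μ_K` obtained from `G_K` by reversing
exactly the edges in `μ`. -/
def MuEdge (K : BasedComplex k V ι) (μ : Set (ι × ι)) (α β : ι) : Prop :=
  (K.Edge α β ∧ (α, β) ∉ μ) ∨ (β, α) ∈ μ

/-- A partial matching on `G_K`: a set of edges, no two of which share a
vertex. -/
def IsPartialMatching (K : BasedComplex k V ι) (μ : Set (ι × ι)) : Prop :=
  (∀ e ∈ μ, K.Edge e.1 e.2) ∧
  ∀ e ∈ μ, ∀ e' ∈ μ, e ≠ e' → e.1 ≠ e'.1 ∧ e.1 ≠ e'.2 ∧ e.2 ≠ e'.1 ∧ e.2 ≠ e'.2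

/-- A Morse matching: a partial matching all of whose matched components are
isomorphisms, together with a well-founded (strict) partial order on each
`I_n` such that any path `α → γ → β` in `G^μ_K` between indices of the same
degree satisfies `β ≺ α`. -/
def IsMorseMatching (K : BasedComplex k V ι) (μ : Set (ι × ι)) : Prop :=
  K.IsPartialMatching μ ∧ (∀ e ∈ μ, K.CompIso e.1 e.2) ∧
  ∃ r : ι → ι → Prop, (∀ a b, r a b → K.deg a = K.deg b) ∧ Transitive r ∧
    WellFounded r ∧
    ∀ α γ β : ι, K.deg β = K.deg α → K.MuEdge μ α γ → K.MuEdge μ γ β → r β α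

/-- A vertex is critical for the matching `μ` if it is incident to no edge
of `μ`. -/
def IsCritical (μ : Set (ι × ι)) (α : ι) : Prop := ∀ e ∈ μ, e.1 ≠ α ∧ e.2 ≠ α

/-- The map `d̃`: the sum of the matched components of the differential. -/
noncomputable def dtilde (K : BasedComplex k V ι) (μ : Set (ι × ι)) : V →ₗ[k] V :=
  ∑ᶠ (e : ι × ι) (_ : e ∈ μ), K.dcomp e.2 e.1

/-- The projection onto the span of the critical pieces. -/
noncomputable def critProj (K : BasedComplex k V ι) (μ : Set (ι × ι)) : V →ₗ[k] V :=
  ∑ᶠ (α : ι) (_ : IsCritical μ α), K.gr.proj α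

/-- The span of the critical pieces, i.e. the chain groups of the Morse
complex `K^{(μ)}`. -/
def critSub (K : BasedComplex k V ι) (μ : Set (ι × ι)) : Submodule k V :=
  ⨆ (α : ι) (_ : IsCritical μ α), K.gr.piece α

/-- `ht` is the map `h̃` associated to the matching: it vanishes on every
piece which is not the target of a matched edge, and on the piece `K^β` with
`(α → β) ∈ μ` it is minus the inverse of `d^{βα}`. -/
def IsHTildeB (K : BasedComplex k V ι) (μ : Set (ι × ι)) (ht : V →ₗ[k] V) : Prop :=
  (∀ c : ι, (¬ ∃ a : ι, (a, c) ∈ μ) → ht ∘ₗ K.gr.proj c = 0) ∧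
  ∀ a b : ι, (a, b) ∈ μ → ∀ v ∈ K.gr.piece b,
    ht v ∈ K.gr.piece a ∧ K.dcomp b a (ht v) = -v

end BasedComplex

/-! ## `P`-graded chain complexes -/

/-- A `P`-graded chain complex: the carrier is graded by `ℤ × P`
(chain degree and poset grade), the differential is square-zero, drops the
chain degree by one and is `P`-filtered: components from grade `q` to grade
`p` vanish unless `p ≤ q`. -/
structure PCC (k V P : Type*) [Field k] [AddCommGroup V] [Module k V]
    [PartialOrder P] where
  gr : VGrading k V (ℤ × P)
  d : V →ₗ[k] V
  d_sq : d ∘ₗ d = 0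
  d_filt : ∀ (n m : ℤ) (p q : P),
    (m = n - 1 ∧ p ≤ q) ∨ gr.proj (m, p) ∘ₗ (d ∘ₗ gr.proj (n, q)) = 0

namespace PCC

variable {k V P : Type*} [Field k] [AddCommGroup V] [Module k V] [PartialOrder P]

/-- The twisted differential `t^{pq}_n : C^q_n → C^p_{n-1}`
(as an endomorphism of the carrier). -/
def tcomp (C : PCC k V P) (n : ℤ) (p q : P) : V →ₗ[k] V :=
  C.gr.proj (n - 1, p) ∘ₗ (C.d ∘ₗ C.gr.proj (n, q))

/-- Only finitely many chain groups are nonzero. -/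
def Bounded (C : PCC k V P) : Prop := {i : ℤ × P | C.gr.proj i ≠ 0}.Finite

/-- Cycles of the relative chain complex `(C^p, t^p)` in degree `n`. -/
def relCycles (C : PCC k V P) (n : ℤ) (p : P) : Submodule k V :=
  LinearMap.range (C.gr.proj (n, p)) ⊓ LinearMap.ker (C.tcomp n p p)

/-- Boundaries of the relative chain complex `(C^p, t^p)` in degree `n`. -/
def relBdries (C : PCC k V P) (n : ℤ) (p : P) : Submodule k V :=
  LinearMap.range (C.tcomp (n + 1) p p)

/-- The relative homology `H_n(C^p, t^p)`. -/
abbrev relHomology (C : PCC k V P) (n : ℤ) (p : P) :=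
  ↥(C.relCycles n p) ⧸ Submodule.comap (C.relCycles n p).subtype (C.relBdries n p)

/-- The diagonal part `d̃ = Σ_p t^p` of the differential. -/
noncomputable def dtilde (C : PCC k V P) : V →ₗ[k] V :=
  ∑ᶠ i : ℤ × P, C.gr.proj (i.1 - 1, i.2) ∘ₗ (C.d ∘ₗ C.gr.proj i)

/-- The strictly off-diagonal part `δ = Σ_{p < q} t^{pq} = d - d̃` of the
differential. -/
noncomputable def delta (C : PCC k V P) : V →ₗ[k] V := C.d - C.dtilde

/-- The sublevel subcomplex `F^p = ⊕_{q ≤ p} C^q`. -/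
def Fle (C : PCC k V P) (p : P) : Submodule k V :=
  ⨆ (i : ℤ × P) (_ : i.2 ≤ p), LinearMap.range (C.gr.proj i)

/-- The strict sublevel subcomplex `F^p̌ = ⊕_{q < p} C^q`. -/
def Flt (C : PCC k V P) (p : P) : Submodule k V :=
  ⨆ (i : ℤ × P) (_ : i.2 < p), LinearMap.range (C.gr.proj i)

/-- The total relative chain group `C^p = ⊕_n C^p_n` at grade `p`. -/
def Cp (C : PCC k V P) (p : P) : Submodule k V :=
  ⨆ n : ℤ, LinearMap.range (C.gr.proj (n, p))

end PCC

/-- A linear map between `(ℤ × P)`-graded spaces is `P`-filtered: its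
components from grade `q` to grade `p` vanish unless `p ≤ q`. -/
def PFilt {k V W P : Type*} [Field k] [AddCommGroup V] [Module k V]
    [AddCommGroup W] [Module k W] [PartialOrder P]
    (GV : VGrading k V (ℤ × P)) (GW : VGrading k W (ℤ × P)) (f : V →ₗ[k] W) : Prop :=
  ∀ (n m : ℤ) (p q : P), ¬ p ≤ q → GW.proj (m, p) ∘ₗ (f ∘ₗ GV.proj (n, q)) = 0

/-- A linear map between `(ℤ × P)`-graded spaces has chain degree `r`. -/
def HasDegZP {k V W P : Type*} [Field k] [AddCommGroup V] [Module k V]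
    [AddCommGroup W] [Module k W] [PartialOrder P]
    (GV : VGrading k V (ℤ × P)) (GW : VGrading k W (ℤ × P)) (f : V →ₗ[k] W)
    (r : ℤ) : Prop :=
  ∀ (n m : ℤ) (p q : P), m ≠ n + r → GW.proj (m, q) ∘ₗ (f ∘ₗ GV.proj (n, p)) = 0

/-- A linear map between `P`-graded spaces is `P`-filtered. -/
def PFilt0 {k V W P : Type*} [Field k] [AddCommGroup V] [Module k V]
    [AddCommGroup W] [Module k W] [PartialOrder P]
    (GW : VGrading k W P) (GV : VGrading k V P) (f : V →ₗ[k] W) : Prop :=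
  ∀ p q : P, ¬ p ≤ q → GW.proj p ∘ₗ (f ∘ₗ GV.proj q) = 0

/-! ## Consistent splittings -/

/-- A consistent splitting of a `P`-graded chain complex: each relative chain
group `C^p_n` is split as an internal direct sum `M^p_n ⊕ B^p_n ⊕ K^p_n`
(recorded by three orthogonal idempotents summing to the grading projection),
where the `B`-summand is the space of relative boundaries `im(t^p_{n+1})`,
the `M`- and `B`-summands together span the relative cycles `ker(t^p_n)`,
and `t^p_n` maps the `K`-summand isomorphically onto `B^p_{n-1}`. -/
structure ConsSplit {k V P : Type*} [Field k] [AddCommGroup V] [Module k V]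
    [PartialOrder P] (C : PCC k V P) where
  piM : ℤ → P → (V →ₗ[k] V)
  piB : ℤ → P → (V →ₗ[k] V)
  piK : ℤ → P → (V →ₗ[k] V)
  sum_eq : ∀ n p, piM n p + piB n p + piK n p = C.gr.proj (n, p)
  idem_M : ∀ n p, piM n p ∘ₗ piM n p = piM n p
  idem_B : ∀ n p, piB n p ∘ₗ piB n p = piB n p
  idem_K : ∀ n p, piK n p ∘ₗ piK n p = piK n p
  orth_MB : ∀ n p, piM n p ∘ₗ piB n p = 0
  orth_BM : ∀ n p, piB n p ∘ₗ piM n p = 0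
  orth_MK : ∀ n p, piM n p ∘ₗ piK n p = 0
  orth_KM : ∀ n p, piK n p ∘ₗ piM n p = 0
  orth_BK : ∀ n p, piB n p ∘ₗ piK n p = 0
  orth_KB : ∀ n p, piK n p ∘ₗ piB n p = 0
  range_B : ∀ n p, LinearMap.range (piB n p) = LinearMap.range (C.tcomp (n + 1) p p)
  ker_split : ∀ n p, LinearMap.range (piM n p) ⊔ LinearMap.range (piB n p)
      = LinearMap.range (C.gr.proj (n, p)) ⊓ LinearMap.ker (C.tcomp n p p)
  K_inj : ∀ n p, ∀ v ∈ LinearMap.range (piK n p), C.tcomp n p p v = 0 → v = 0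
  K_onto : ∀ n p, (LinearMap.range (piK n p)).map (C.tcomp n p p)
      = LinearMap.range (piB (n - 1) p)

namespace ConsSplit

variable {k V P : Type*} [Field k] [AddCommGroup V] [Module k V] [PartialOrder P]
  {C : PCC k V P}

/-- The projection `j_M` onto the total Morse summand `M = ⊕_{n,p} M^p_n`. -/
noncomputable def projM (sp : ConsSplit C) : V →ₗ[k] V := ∑ᶠ i : ℤ × P, sp.piM i.1 i.2

/-- The projection `j_K` onto the total preboundary summand. -/
noncomputable def projK (sp : ConsSplit C) : V →ₗ[k] V := ∑ᶠ i : ℤ × P, sp.piK i.1 i.2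

/-- The total Morse summand `M = ⊕_{n,p} M^p_n` as a submodule; this is the
underlying space of the Conley (Morse) complex. -/
def Msub (sp : ConsSplit C) : Submodule k V := ⨆ i : ℤ × P, LinearMap.range (sp.piM i.1 i.2)

/-- The differential `d̃ = i_B ∘ (⊕_p t^p|_{K^p}) ∘ j_K`. -/
noncomputable def dtildeK (sp : ConsSplit C) : V →ₗ[k] V :=
  ∑ᶠ i : ℤ × P, C.tcomp i.1 i.2 i.2 ∘ₗ sp.piK i.1 i.2

/-- `ht` is the map `h̃ = -i_K ∘ (⊕_p (t^p|_{K^p})^{-1}) ∘ j_B`: it vanishes on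
the `M`- and `K`-summands, and on each `B^p_n` it is minus the inverse of the
isomorphism `t^p_{n+1} : K^p_{n+1} → B^p_n`. -/
def IsHTilde (sp : ConsSplit C) (ht : V →ₗ[k] V) : Prop :=
  (∀ n p, ht ∘ₗ sp.piM n p = 0) ∧ (∀ n p, ht ∘ₗ sp.piK n p = 0) ∧
  ∀ n p, ∀ v ∈ LinearMap.range (sp.piB n p),
    ht v ∈ LinearMap.range (sp.piK (n + 1) p) ∧ C.tcomp (n + 1) p p (ht v) = -v

end ConsSplit

/-! ## Ordered bases, pivots and separating bases -/

/-- `i` is the pivot index of `v` with respect to the coordinate functions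
`coord`: the largest index at which `v` has a nonzero coefficient. -/
def IsPivot {k V : Type*} [Field k] [AddCommGroup V] [Module k V] {m : ℕ}
    (coord : Fin m → V →ₗ[k] k) (v : V) (i : Fin m) : Prop :=
  coord i v ≠ 0 ∧ ∀ j : Fin m, coord j v ≠ 0 → j ≤ i

/-- `A n` is a totally ordered (by the order of `Fin (m n)`) basis of the
`n`-th chain group, with coordinate functionals `coord n`. -/
def IsOrderedBasisData {k V : Type*} [Field k] [AddCommGroup V] [Module k V]
    (C : ZCC k V) (m : ℤ → ℕ) (A : ∀ n : ℤ, Fin (m n) → V)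
    (coord : ∀ n : ℤ, Fin (m n) → V →ₗ[k] k) : Prop :=
  ∀ n : ℤ, (∀ i, A n i ∈ C.gr.piece n) ∧ LinearIndependent k (A n) ∧
    Submodule.span k (Set.range (A n)) = C.gr.piece n ∧
    ∀ v ∈ C.gr.piece n, v = ∑ i : Fin (m n), coord n i v • A n i

/-- `(H, B, Pp)` is a family of separating bases: for each `n`, the triple
`(H n, B n, Pp n)` is a separating basis for the `n`-th chain group with
respect to the ordered basis `A n`. -/
def IsSepSystem {k V : Type*} [Field k] [AddCommGroup V] [Module k V]
    (C : ZCC k V) (m : ℤ → ℕ) (A : ∀ n : ℤ, Fin (m n) → V)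
    (coord : ∀ n : ℤ, Fin (m n) → V →ₗ[k] k) (H B Pp : ℤ → Set V) : Prop :=
  ∀ n : ℤ,
    (H n ⊆ C.gr.piece n) ∧ (B n ⊆ C.gr.piece n) ∧ (Pp n ⊆ C.gr.piece n) ∧
    (H n).Finite ∧ (B n).Finite ∧ (Pp n).Finite ∧
    LinearIndependent k (fun x : ↥(H n) => (x : V)) ∧
    LinearIndependent k (fun x : ↥(B n) => (x : V)) ∧
    LinearIndependent k (fun x : ↥(Pp n) => (x : V)) ∧
    Disjoint (Submodule.span k (H n)) (Submodule.span k (B n)) ∧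
    Disjoint (Submodule.span k (H n) ⊔ Submodule.span k (B n))
      (Submodule.span k (Pp n)) ∧
    (Submodule.span k (H n) ⊔ Submodule.span k (B n) ⊔ Submodule.span k (Pp n)
      = C.gr.piece n) ∧
    Submodule.span k (B n) = C.bdries n ∧
    (Submodule.span k (H n) ⊔ Submodule.span k (B n) = C.cycles n) ∧
    (∀ v ∈ Pp n, C.d v ∈ B (n - 1)) ∧
    (∀ v ∈ H n ∪ Pp n, ∀ b ∈ B n, ∀ i, IsPivot (coord n) b i → coord n i v = 0) ∧
    (∀ z ∈ H n, ∀ i, IsPivot (coord n) z i →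
      ∀ v, ((v ∈ H n ∧ v ≠ z) ∨ v ∈ Pp n) → coord n i v = 0) ∧
    (∀ z ∈ H n, ∀ i, IsPivot (coord n) z i → coord n i z = 1)

/-- The set of basis vectors which are pivots of elements of `H`. -/
def pivotVecs {k V : Type*} [Field k] [AddCommGroup V] [Module k V] {mm : ℕ}
    (coord : Fin mm → V →ₗ[k] k) (A : Fin mm → V) (H : Set V) : Set V :=
  {w : V | ∃ z ∈ H, ∃ i : Fin mm, IsPivot coord z i ∧ w = A i}
theorem IsPivot.unique {k V : Type*} [Field k] [AddCommGroup V] [Module k V] {m : ℕ}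
    {coord : Fin m → V →ₗ[k] k} {v : V} {i j : Fin m}
    (hi : IsPivot coord v i) (hj : IsPivot coord v j) : i = j :=
  le_antisymm (hj.2 i hi.1) (hi.2 j hj.1)

theorem exists_isPivot {k V : Type*} [Field k] [AddCommGroup V] [Module k V] {m : ℕ}
    {coord : Fin m → V →ₗ[k] k} {v : V} (hv : ∃ i, coord i v ≠ 0) :
    ∃ i, IsPivot coord v i := by
  classical
  obtain ⟨j, hj⟩ := hv
  have hne : (Finset.univ.filter fun i => coord i v ≠ 0).Nonempty := ⟨j, by simpa using hj⟩
  refine ⟨Finset.max' _ hne, ?_, fun l hl => Finset.le_max' _ _ (by simpa using hl)⟩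
  simpa using Finset.max'_mem _ hne

/-- Two linearly independent families with the same finite index type determine a linear
equivalence between their spans. -/
theorem exists_linearEquiv_span {k V ι : Type*} [Field k] [AddCommGroup V] [Module k V]
    [Fintype ι] {f g : ι → V} (hf : LinearIndependent k f) (hg : LinearIndependent k g)
    {s t : Set V} (hs : s = Set.range f) (ht : t = Set.range g) :
    ∃ θ : ↥(Submodule.span k s) ≃ₗ[k] ↥(Submodule.span k t),
      ∀ (x : ↥(Submodule.span k s)) (c : ι → k),
        (x : V) = ∑ i, c i • f i → (θ x : V) = ∑ i, c i • g i := by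
  subst hs ht
  refine ⟨(Module.Basis.span hf).equiv (Module.Basis.span hg) (Equiv.refl ι), fun x c hx => ?_⟩
  have hx' : x = ∑ i, c i • Module.Basis.span hf i := by
    apply Subtype.ext
    simp [hx, Module.Basis.span_apply]
  rw [hx', map_sum, Submodule.coe_sum]
  refine Finset.sum_congr rfl fun i _ => ?_
  rw [map_smul, Module.Basis.equiv_apply, Submodule.coe_smul, Module.Basis.span_apply]
  rfl

/-- Let `(ℌ_n, 𝔅_n, 𝔓_n)` be a separating basis for `C_n`
with respect to the ordered basis `𝔄_n`, and write `F_n = span(ℌ_n)`,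
`P_n = span(𝔓_n)`.  Then the assignment `ρ(z) ↦ z` for `z ∈ ℌ_n` defines a
linear isomorphism `θ_n : span(ρ(ℌ_n)) → F_n`, and on `F_n ⊕ P_n` the
projection onto `F_n` (along `span(𝔅_n) ⊕ P_n`) agrees with
`θ_n ∘ j_{ρ(ℌ_n)}`. -/
theorem stmt8 {k V : Type*} [Field k] [AddCommGroup V] [Module k V]
    (C : ZCC k V)
    (m : ℤ → ℕ) (A : ∀ n : ℤ, Fin (m n) → V)
    (coord : ∀ n : ℤ, Fin (m n) → V →ₗ[k] k)
    (hbasis : IsOrderedBasisData C m A coord)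
    (H B Pp : ℤ → Set V) (hsep : IsSepSystem C m A coord H B Pp)
    (n : ℤ) :
    ∃ θ : ↥(Submodule.span k (pivotVecs (coord n) (A n) (H n)))
          ≃ₗ[k] ↥(Submodule.span k (H n)),
      -- `θ` sends `ρ(z)` to `z` for every `z ∈ ℌ_n`:
      (∀ (x : ↥(Submodule.span k (pivotVecs (coord n) (A n) (H n)))),
        ∀ z ∈ H n, ∀ i : Fin (m n), IsPivot (coord n) z i →
          (x : V) = A n i → (θ x : V) = z) ∧
      -- on `F_n ⊕ P_n`, the projection onto `F_n` agrees with `θ ∘ j_{ρ(ℌ_n)}`: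
      (∀ v vF vP : V, vF ∈ Submodule.span k (H n) → vP ∈ Submodule.span k (Pp n) →
        v = vF + vP →
        ∀ x : ↥(Submodule.span k (pivotVecs (coord n) (A n) (H n))),
          (x : V) = (∑ᶠ (i : Fin (m n))
              (_ : ∃ z ∈ H n, IsPivot (coord n) z i), coord n i v • A n i) →
          (θ x : V) = vF) := by
  classical
  obtain ⟨-, hA, -, hexp⟩ := hbasis n
  obtain ⟨hHC, -, -, hfin, -, -, hH, -, -, -, -, -, -, -, -, -, hsepz, hone⟩ := hsep n
  have : Fintype ↥(H n) := hfin.fintype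
  have hpiv : ∀ z : ↥(H n), ∃ i, IsPivot (coord n) (z : V) i := by
    intro z
    apply exists_isPivot
    by_contra! h
    apply hH.ne_zero z
    rw [hexp z (hHC z.2)]
    simp [h]
  choose p hp using hpiv
  have hcoord : ∀ z w : ↥(H n), coord n (p z) (w : V) = if w = z then 1 else 0 := by
    intro z w
    split_ifs with h
    · subst h
      exact hone w w.2 _ (hp w)
    · exact hsepz z z.2 _ (hp z) w (Or.inl ⟨w.2, fun e => h (Subtype.ext e)⟩)
  have hpinj : Function.Injective p := by
    intro z w h
    by_contra hne
    exact (hp z).1 (by rw [h, hcoord w z, if_neg hne])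
  obtain ⟨θ, hθ⟩ := exists_linearEquiv_span (hA.comp p hpinj) hH
    (s := pivotVecs (coord n) (A n) (H n)) (t := H n)
    (by
      ext w
      constructor
      · rintro ⟨z, hz, i, hi, rfl⟩
        exact ⟨⟨z, hz⟩, congrArg (A n) ((hp ⟨z, hz⟩).unique hi)⟩
      · rintro ⟨z, rfl⟩
        exact ⟨z, z.2, p z, hp z, rfl⟩)
    Subtype.range_coe.symm
  refine ⟨θ, fun x z hz i hi hx => ?_, fun v vF vP hF hP hv x hx => ?_⟩
  · have := hθ x (Pi.single ⟨z, hz⟩ 1) (by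
      simp [Pi.single_apply, ite_smul, hx, (hp ⟨z, hz⟩).unique hi])
    simpa [Pi.single_apply, ite_smul] using this
  · have hF' : vF ∈ Submodule.span k (Set.range fun z : ↥(H n) => (z : V)) := by
      rwa [Subtype.range_coe]
    obtain ⟨c, hc⟩ := (Submodule.mem_span_range_iff_exists_fun k).1 hF'
    have hcv : ∀ z, coord n (p z) v = c z := by
      intro z
      have hPz : coord n (p z) vP = 0 :=
        (Submodule.span_le (p := LinearMap.ker (coord n (p z)))).2
          (fun w hw => hsepz z z.2 _ (hp z) w (Or.inr hw)) hP
      rw [hv, map_add, hPz, ← hc]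
      simp [hcoord]
    have hrange : ∀ i, (∃ z ∈ H n, IsPivot (coord n) z i) ↔ i ∈ Set.range p := by
      refine fun i => ⟨?_, ?_⟩
      · rintro ⟨z, hz, hi⟩
        exact ⟨⟨z, hz⟩, (hp ⟨z, hz⟩).unique hi⟩
      · rintro ⟨z, rfl⟩
        exact ⟨z, z.2, hp z⟩
    rw [← hc]
    apply hθ
    rw [hx]
    simp_rw [hrange]
    rw [finsum_mem_range hpinj, finsum_eq_sum_of_fintype]
    simp [hcv]
end

section
/- Let k be a field, P a finite poset, and (C,d) a bounded P-graded chain complex of finite-dimensional k-vector spaces with a consistent splitting, and let f̃ = j_M, g̃ = i_M, h̃, δ, S be the associated maps, with d^M = f̃Sg̃ = j_M S i_M. Fix p ∈ P, let z be an element of the M-summand M^p_n ⊆ C^p_n, and let y ∈ C_n be an element whose component y^q lies in the K-summand K^q_n for every q < p and whose components vanish at all other grades. If for every s ∈ P the component (d(z+y))^s lies in M^s_{n-1} ⊕ K^s_{n-1}, then j_M(d(z+y)) = d^M(z). -/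
open LinearMap Submodule

/-! ## Perturbation sums -/

theorem endPow_succ_apply {k V : Type*} [Field k] [AddCommGroup V] [Module k V]
    (f : V →ₗ[k] V) (m : ℕ) (v : V) : endPow f (m + 1) v = endPow f m (f v) := by
  induction m with
  | zero => rfl
  | succ m ih =>
    change f (endPow f (m + 1) v) = f (endPow f m (f v))
    rw [ih]

theorem IsPerturbSum.eq_sum {k V : Type*} [Field k] [AddCommGroup V] [Module k V]
    {δ h S : V →ₗ[k] V} (hS : IsPerturbSum δ h S) (v : V) :
    ∃ N : ℕ, ∀ m, N ≤ m → S v = ∑ i ∈ Finset.range m, δ (endPow (h ∘ₗ δ) i v) := by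
  obtain ⟨N, hN, hSv⟩ := hS v
  refine ⟨N, fun m hm => hSv.trans ?_⟩
  refine Finset.sum_subset (Finset.range_mono hm) fun i _ hi => ?_
  rw [LinearMap.comp_apply, hN i (by simpa using hi), map_zero]

/-- The recursion `S = δ + S (h δ)`. -/
theorem IsPerturbSum.apply_eq {k V : Type*} [Field k] [AddCommGroup V] [Module k V]
    {δ h S : V →ₗ[k] V} (hS : IsPerturbSum δ h S) (v : V) :
    S v = δ v + S (h (δ v)) := by
  obtain ⟨N₁, h₁⟩ := hS.eq_sum v
  obtain ⟨N₂, h₂⟩ := hS.eq_sum (h (δ v))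
  rw [h₁ (max N₁ N₂ + 1) (by omega), h₂ (max N₁ N₂) (by omega), Finset.sum_range_succ',
    add_comm]
  congr 1
  exact Finset.sum_congr rfl fun i _ => by rw [endPow_succ_apply]; rfl

theorem finsum_linearMap_apply {k V W ι : Type*} [Field k] [AddCommGroup V] [Module k V]
    [AddCommGroup W] [Module k W] (F : ι → V →ₗ[k] W) (T : Finset ι)
    (hT : ∀ i ∉ T, F i = 0) (v : V) : (∑ᶠ i, F i) v = ∑ i ∈ T, F i v := by
  rw [finsum_eq_sum_of_support_subset F (s := T), LinearMap.sum_apply]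
  intro i hi
  by_contra h
  exact hi (hT i h)

namespace VGrading

variable {k V ι : Type*} [Field k] [AddCommGroup V] [Module k V]

theorem proj_self (G : VGrading k V ι) (i : ι) (v : V) :
    G.proj i (G.proj i v) = G.proj i v :=
  LinearMap.congr_fun (G.proj_idem i) v

theorem proj_ne (G : VGrading k V ι) {i j : ι} (h : i ≠ j) (v : V) :
    G.proj i (G.proj j v) = 0 :=
  LinearMap.congr_fun (G.proj_orth i j h) v

theorem sum_proj (G : VGrading k V ι) (T : Finset ι) (hT : ∀ i ∉ T, G.proj i = 0) (v : V) :
    ∑ i ∈ T, G.proj i v = v := by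
  rw [← finsum_eq_sum_of_support_subset, G.proj_total]
  intro i hi
  by_contra h
  exact hi (by simp [hT i h])

end VGrading

namespace PCC

variable {k V P : Type*} [Field k] [AddCommGroup V] [Module k V] [PartialOrder P]

theorem Bounded.exists_finset {C : PCC k V P} (hbd : C.Bounded) :
    ∃ T : Finset (ℤ × P), ∀ i ∉ T, C.gr.proj i = 0 :=
  ⟨Set.Finite.toFinset hbd, fun _ hi => by_contra fun h =>
    hi ((Set.Finite.mem_toFinset hbd).2 h)⟩

theorem dtilde_apply (C : PCC k V P) {T : Finset (ℤ × P)} (hT : ∀ i ∉ T, C.gr.proj i = 0)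
    (v : V) : C.dtilde v = ∑ i ∈ T, C.tcomp i.1 i.2 i.2 v :=
  finsum_linearMap_apply _ T (fun i hi => by simp [hT i hi]) v

theorem tcomp_proj (C : PCC k V P) (n : ℤ) (p q : P) (v : V) :
    C.tcomp n p q (C.gr.proj (n, q) v) = C.tcomp n p q v := by
  simp [tcomp, C.gr.proj_self]

/-- The differential of a vector of chain degree `n` has chain degree `n - 1`. -/
theorem proj_d_eq_zero (C : PCC k V P) (hbd : C.Bounded) {n m : ℤ} (hm : m ≠ n - 1) (s : P)
    {v : V} (hv : ∀ j q, j ≠ n → C.gr.proj (j, q) v = 0) : C.gr.proj (m, s) (C.d v) = 0 := by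
  obtain ⟨T, hT⟩ := hbd.exists_finset
  rw [← C.gr.sum_proj T hT v, map_sum, map_sum]
  refine Finset.sum_eq_zero fun i _ => ?_
  obtain ⟨j, q⟩ := i
  by_cases hj : j = n
  · subst hj
    rcases C.d_filt j m s q with h | h
    · exact absurd h.1 hm
    · exact LinearMap.congr_fun h v
  · rw [hv j q hj, map_zero, map_zero]

end PCC

namespace ConsSplit

variable {k V P : Type*} [Field k] [AddCommGroup V] [Module k V] [PartialOrder P]
  {C : PCC k V P}

theorem proj_eq (sp : ConsSplit C) (n : ℤ) (p : P) (v : V) :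
    C.gr.proj (n, p) v = sp.piM n p v + sp.piB n p v + sp.piK n p v := by
  rw [← sp.sum_eq]; rfl

theorem piM_proj (sp : ConsSplit C) (n : ℤ) (p : P) (v : V) :
    sp.piM n p (C.gr.proj (n, p) v) = sp.piM n p v := by
  rw [sp.proj_eq, map_add, map_add]
  have h₁ := LinearMap.congr_fun (sp.idem_M n p) v
  have h₂ := LinearMap.congr_fun (sp.orth_MB n p) v
  have h₃ := LinearMap.congr_fun (sp.orth_MK n p) v
  simp only [LinearMap.comp_apply, LinearMap.zero_apply] at h₁ h₂ h₃
  rw [h₁, h₂, h₃, add_zero, add_zero]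

theorem mem_ker_of_mem_piM (sp : ConsSplit C) {n : ℤ} {p : P} {v : V}
    (hv : v ∈ LinearMap.range (sp.piM n p)) :
    v ∈ LinearMap.range (C.gr.proj (n, p)) ∧ C.tcomp n p p v = 0 := by
  have h : v ∈ LinearMap.range (C.gr.proj (n, p)) ⊓ LinearMap.ker (C.tcomp n p p) := by
    rw [← sp.ker_split]
    exact Submodule.mem_sup_left hv
  exact h

theorem mem_range_proj_of_mem_piB (sp : ConsSplit C) {n : ℤ} {p : P} {v : V}
    (hv : v ∈ LinearMap.range (sp.piB n p)) : v ∈ LinearMap.range (C.gr.proj (n, p)) := by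
  have h : v ∈ LinearMap.range (C.gr.proj (n, p)) ⊓ LinearMap.ker (C.tcomp n p p) := by
    rw [← sp.ker_split]
    exact Submodule.mem_sup_right hv
  exact h.1

theorem projM_apply (sp : ConsSplit C) {T : Finset (ℤ × P)} (hT : ∀ i ∉ T, C.gr.proj i = 0)
    (v : V) : sp.projM v = ∑ i ∈ T, sp.piM i.1 i.2 v := by
  refine finsum_linearMap_apply _ T (fun i hi => ?_) v
  ext u
  rw [← sp.piM_proj, hT i hi]
  simp

/-- The projection onto the Morse summand kills the `B`-summands. -/
theorem projM_eq_zero (sp : ConsSplit C) (hbd : C.Bounded) {n : ℤ} {p : P} {v : V}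
    (hv : v ∈ LinearMap.range (sp.piB n p)) : sp.projM v = 0 := by
  obtain ⟨T, hT⟩ := hbd.exists_finset
  rw [sp.projM_apply hT]
  refine Finset.sum_eq_zero fun i _ => ?_
  by_cases hi : i = (n, p)
  · subst hi
    obtain ⟨u, rfl⟩ := hv
    exact LinearMap.congr_fun (sp.orth_MB n p) u
  · obtain ⟨u, rfl⟩ := sp.mem_range_proj_of_mem_piB hv
    rw [← sp.piM_proj, C.gr.proj_ne hi, map_zero]

theorem projM_dtilde (sp : ConsSplit C) (hbd : C.Bounded) (v : V) :
    sp.projM (C.dtilde v) = 0 := by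
  obtain ⟨T, hT⟩ := hbd.exists_finset
  rw [C.dtilde_apply hT, map_sum]
  refine Finset.sum_eq_zero fun i _ => sp.projM_eq_zero hbd (n := i.1 - 1) (p := i.2) ?_
  rw [sp.range_B, sub_add_cancel]
  exact ⟨v, rfl⟩

theorem dtilde_eq_zero (sp : ConsSplit C) (hbd : C.Bounded) {n : ℤ} {p : P} {z : V}
    (hz : z ∈ LinearMap.range (sp.piM n p)) : C.dtilde z = 0 := by
  obtain ⟨T, hT⟩ := hbd.exists_finset
  rw [C.dtilde_apply hT]
  refine Finset.sum_eq_zero fun i _ => ?_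
  obtain ⟨hz₁, hz₂⟩ := sp.mem_ker_of_mem_piM hz
  by_cases hi : i = (n, p)
  · subst hi
    exact hz₂
  · obtain ⟨u, rfl⟩ := hz₁
    rw [← C.tcomp_proj, C.gr.proj_ne hi, map_zero]

variable {ht : V →ₗ[k] V}

/-- `h̃` is minus a left inverse of `t` on each `K`-summand. -/
theorem IsHTilde.apply_tcomp {sp : ConsSplit C} (hht : sp.IsHTilde ht) {n : ℤ} {p : P} {v : V}
    (hv : v ∈ LinearMap.range (sp.piK n p)) : ht (C.tcomp n p p v) = -v := by
  have hB : C.tcomp n p p v ∈ LinearMap.range (sp.piB (n - 1) p) := by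
    rw [← sp.K_onto]
    exact Submodule.mem_map_of_mem hv
  have h := hht.2.2 (n - 1) p _ hB
  rw [sub_add_cancel] at h
  refine eq_neg_of_add_eq_zero_left (sp.K_inj n p _ (add_mem h.1 hv) ?_)
  rw [map_add, h.2, neg_add_cancel]

theorem IsHTilde.apply_dtilde {sp : ConsSplit C} (hht : sp.IsHTilde ht) (hbd : C.Bounded)
    {y : V} (hy : ∀ n q, C.gr.proj (n, q) y ∈ LinearMap.range (sp.piK n q)) :
    ht (C.dtilde y) = -y := by
  obtain ⟨T, hT⟩ := hbd.exists_finset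
  rw [C.dtilde_apply hT, map_sum, ← C.gr.sum_proj T hT (-y)]
  refine Finset.sum_congr rfl fun i _ => ?_
  rw [← C.tcomp_proj, hht.apply_tcomp (hy i.1 i.2), map_neg]

theorem IsHTilde.apply_eq_zero {sp : ConsSplit C} (hht : sp.IsHTilde ht) (hbd : C.Bounded)
    {v : V} (hv : ∀ n q, C.gr.proj (n, q) v = 0 ∨ sp.piB n q v = 0) : ht v = 0 := by
  obtain ⟨T, hT⟩ := hbd.exists_finset
  rw [← C.gr.sum_proj T hT v, map_sum]
  refine Finset.sum_eq_zero fun i _ => ?_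
  rcases hv i.1 i.2 with h | h
  · rw [h, map_zero]
  · have h₁ := LinearMap.congr_fun (hht.1 i.1 i.2) v
    have h₂ := LinearMap.congr_fun (hht.2.1 i.1 i.2) v
    simp only [LinearMap.comp_apply, LinearMap.zero_apply] at h₁ h₂
    rw [sp.proj_eq i.1 i.2, h, add_zero, map_add, h₁, h₂, add_zero]

end ConsSplit

/-- Let `(C, d)` be a bounded `P`-graded chain complex of
finite-dimensional vector spaces with a consistent splitting, with associated
maps `f̃ = j_M`, `g̃ = i_M`, `h̃`, `δ`, `S` and `d^M = f̃Sg̃ = j_M S i_M`.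
Fix `p`, let `z ∈ M^p_n` and let `y ∈ C_n` have components in `K^q_n` for
`q < p` and vanishing components at all other grades.  If for every `s` the
component of `d(z + y)` at grade `s` lies in `M^s_{n-1} ⊕ K^s_{n-1}`, then
`j_M(d(z + y)) = d^M(z)`. -/
theorem stmt10 {k V P : Type*} [Field k] [AddCommGroup V] [Module k V]
    [PartialOrder P] [Fintype P]
    (C : PCC k V P) (hbd : C.Bounded) [FiniteDimensional k V]
    (sp : ConsSplit C)
    (ht : V →ₗ[k] V) (hht : sp.IsHTilde ht)
    (S : V →ₗ[k] V) (hS : IsPerturbSum C.delta ht S)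
    (p : P) (n : ℤ) (z y : V)
    (hz : z ∈ LinearMap.range (sp.piM n p))
    (hy1 : ∀ q : P, q < p → C.gr.proj (n, q) y ∈ LinearMap.range (sp.piK n q))
    (hy2 : ∀ (m : ℤ) (q : P), ¬ (m = n ∧ q < p) → C.gr.proj (m, q) y = 0)
    (hB : ∀ s : P, sp.piB (n - 1) s (C.d (z + y)) = 0) :
    sp.projM (C.d (z + y)) = sp.projM (S z) := by
  obtain ⟨u, hu⟩ := (sp.mem_ker_of_mem_piM hz).1
  have hdeg : ∀ j q, j ≠ n → C.gr.proj (j, q) (z + y) = 0 := fun j q hj => by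
    rw [map_add, hy2 j q fun h => hj h.1, ← hu, C.gr.proj_ne fun h => hj (congrArg Prod.fst h),
      add_zero]
  have hyK : ∀ m q, C.gr.proj (m, q) y ∈ LinearMap.range (sp.piK m q) := fun m q => by
    by_cases h : m = n ∧ q < p
    · obtain ⟨rfl, hq⟩ := h
      exact hy1 q hq
    · rw [hy2 m q h]
      exact zero_mem _
  have hd : C.d (z + y) = C.delta (z + y) + C.dtilde y := by
    have hw : C.dtilde (z + y) = C.dtilde y := by
      rw [map_add, sp.dtilde_eq_zero hbd hz, zero_add]
    rw [← hw, PCC.delta, LinearMap.sub_apply, sub_add_cancel]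
  have h0 : ht (C.d (z + y)) = 0 := hht.apply_eq_zero hbd fun m s => by
    by_cases hm : m = n - 1
    · subst hm
      exact Or.inr (hB s)
    · exact Or.inl (C.proj_d_eq_zero hbd hm s hdeg)
  have hfix : ht (C.delta (z + y)) = y := by
    rwa [hd, map_add, hht.apply_dtilde hbd hyK, ← sub_eq_add_neg, sub_eq_zero] at h0
  have hSz : S z = C.delta (z + y) := by
    have h := hS.apply_eq (z + y)
    rw [hfix, map_add S z y] at h
    exact add_right_cancel h
  rw [hSz, hd, map_add, sp.projM_dtilde hbd, add_zero]
end
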